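/- Let N, N', d ∈ ℕ with d ≥ 1 and 2N > N', and let M = {(Z,w) ∈ ℂ^N × ℂ : Im w = |z_1|² + ⋯ + |z_N|²} ⊆ ℂ^{N+1}. Let P_{k} denote the finite-dimensional real vector space of polynomial maps from ℝ^{2(N'+1)} ≅ ℂ^{N'+1} to ℝ^d of degree at most k vanishing at 0. Then there exist k₀ ∈ ℕ and a real polynomial function Q on P_{k₀} with Q not identically zero, such that the following holds: for every real-analytic map ρ' : U → ℝ^d defined on an open neighborhood U of 0 in ℂ^{N'+1} with ρ'(0) = 0, if there exists a holomorphic map Ψ from an open neighborhood V of 0 in ℂ^{N+1} to ℂ^{N'+1} which is injective, has injective derivative at every point of V, satisfies Ψ(0) = 0 and Ψ(M ∩ V) ⊆ {ρ' = 0}, then Q(T_{k₀}ρ') = 0, where T_{k₀}ρ' ∈ P_{k₀} is the Taylor polynomial of ρ' at 0 of degree k₀. -/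

import Mathlib

open Complex Topology

noncomputable section

/-- `ℂ^n`. -/
abbrev Cn (n : ℕ) : Type := EuclideanSpace ℂ (Fin n)

/-- Real basis vectors of `ℂ^n`: `e_j` and `i e_j`. -/
def rbasis (n : ℕ) : Fin n × Bool → Cn n :=
  fun x => EuclideanSpace.single x.1 (if x.2 then Complex.I else 1)

/-- The list in which each real direction `x` of `ℂ^n` is repeated `β x` times. -/
def rmultiList (n : ℕ) (β : Fin n × Bool → ℕ) : List (Fin n × Bool) :=
  (((List.finRange n).flatMap fun i => [(i, false), (i, true)]).flatMap
    fun x => List.replicate (β x) x)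

/-- The real multi-index partial derivative `D^β f (q)` of `f : ℂ^n → ℝ`. -/
def rmderiv {n : ℕ} (β : Fin n × Bool → ℕ) (f : Cn n → ℝ) (q : Cn n) : ℝ :=
  iteratedFDeriv ℝ (rmultiList n β).length f q
    fun j => rbasis n ((rmultiList n β).get j)

/-- Multi-indices `β` with `1 ≤ |β| ≤ k` in the real coordinates of `ℂ^n`; these index the
coefficient space `P_k` of polynomial maps `ℂ^n → ℝ^d` of degree at most `k` vanishing
at `0`. -/
abbrev MIdx (n k : ℕ) : Type :=
  {β : Fin n × Bool → Fin (k + 1) // 1 ≤ ∑ x, (β x : ℕ) ∧ ∑ x, (β x : ℕ) ≤ k}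

/-- The Taylor coefficients at `0` up to order `k` of `ρ' : ℂ^n → ℝ^d`, i.e. the Taylor
polynomial `T_k ρ'` as an element of the coefficient space `P_k`. -/
def taylorCoeff {n d : ℕ} (k : ℕ) (ρ' : Cn n → Fin d → ℝ) : MIdx n k × Fin d → ℝ :=
  fun x => rmderiv (fun y => (x.1.1 y : ℕ)) (fun w => ρ' w x.2) 0 /
    (∏ y, Nat.factorial (x.1.1 y : ℕ) : ℝ)


lemma aux_algdep {σ κ : Type} [Fintype σ] [Fintype κ] (h : Fintype.card σ < Fintype.card κ)
    (g : κ → MvPolynomial σ ℝ) : ∃ Q : MvPolynomial κ ℝ, Q ≠ 0 ∧ MvPolynomial.aeval g Q = 0 := by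
  by_contra hcon
  push Not at hcon
  have hind : AlgebraicIndependent ℝ g := by
    rw [algebraicIndependent_iff]
    intro p hp
    by_contra hne
    exact hcon p hne hp
  have := hind.cardinalMk_le_trdeg
  rw [MvPolynomial.trdeg_of_isDomain] at this
  simp at this
  omega

lemma aux_elim {σ R κ : Type} [Fintype σ] [Fintype R] [Fintype κ] [DecidableEq R]
    (A : Matrix R κ (MvPolynomial σ ℝ)) (s : R → κ) (hs : Function.Injective s)
    (h : Fintype.card σ < Fintype.card R) :
    ∃ Q : MvPolynomial κ ℝ, Q ≠ 0 ∧ ∀ (a : σ → ℝ) (c : κ → ℝ),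
      (A.map (MvPolynomial.eval a)).mulVec c = 0 →
      ((A.map (MvPolynomial.eval a)).submatrix id s).det ≠ 0 → MvPolynomial.eval c Q = 0 := by
  classical
  let σ' := σ ⊕ {j : κ // j ∉ Set.range s}
  let ι : MvPolynomial σ ℝ →+* MvPolynomial σ' ℝ := (MvPolynomial.rename Sum.inl).toRingHom
  let Xe : κ → MvPolynomial σ' ℝ := fun j =>
    if hj : j ∉ Set.range s then MvPolynomial.X (Sum.inr ⟨j, hj⟩) else 0
  let S : Matrix R R (MvPolynomial σ' ℝ) := (A.map ι).submatrix id s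
  let u : R → MvPolynomial σ' ℝ := - (S.adjugate.mulVec ((A.map ι).mulVec Xe))
  let g : κ → MvPolynomial σ' ℝ := fun j => S.det * Xe j + Function.extend s u 0 j
  have hcard : Fintype.card σ' < Fintype.card κ := by
    have h1 : Fintype.card {j : κ // j ∉ Set.range s} = Fintype.card κ - Fintype.card R := by
      rw [Fintype.card_subtype_compl]
      congr 1
      exact (Fintype.card_congr (Equiv.ofInjective s hs)).symm
    have h2 := Fintype.card_le_of_injective s hs
    simp only [σ', Fintype.card_sum, h1]
    omega
  obtain ⟨Q, hQ, hQ0⟩ := aux_algdep hcard g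
  refine ⟨Q, hQ, fun a c hc hD => ?_⟩
  set A' := A.map (MvPolynomial.eval a) with hA'
  set D := (A'.submatrix id s).det with hDdef
  let e : σ' → ℝ := Sum.elim a (fun j => c j.1 / D)
  have hι : ∀ p, MvPolynomial.eval e (ι p) = MvPolynomial.eval a p := by
    intro p
    simp only [ι, AlgHom.toRingHom_eq_coe, RingHom.coe_coe, MvPolynomial.eval_rename]
    rfl
  have hmapA : (A.map ι).map (MvPolynomial.eval e) = A' := by
    ext i j; simp [hA', hι]
  have hmapS : S.map (MvPolynomial.eval e) = A'.submatrix id s := by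
    rw [← hmapA]; rfl
  let xe : κ → ℝ := fun j => MvPolynomial.eval e (Xe j)
  have hxe1 : ∀ j, j ∉ Set.range s → xe j = c j / D := by
    intro j hj
    simp only [xe, Xe, dif_pos hj, MvPolynomial.eval_X, e, Sum.elim_inr]
  have hxe2 : ∀ r, xe (s r) = 0 := by
    intro r
    simp only [xe, Xe]
    rw [dif_neg (by simp), map_zero]
  have hb : D • A'.mulVec xe = - (A'.submatrix id s).mulVec (c ∘ s) := by
    rw [eq_neg_iff_add_eq_zero, ← hc, ← Matrix.mulVec_smul]
    ext r
    simp only [Pi.add_apply, Matrix.mulVec, dotProduct, Matrix.submatrix_apply, id,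
      Function.comp, Pi.smul_apply, smul_eq_mul]
    have h3 : ∑ i, A' r (s i) * c (s i) = ∑ j, if j ∈ Set.range s then A' r j * c j else 0 := by
      rw [← Finset.sum_filter]
      rw [← Finset.sum_image (s := Finset.univ) (g := s) (f := fun j => A' r j * c j)
        (fun x _ y _ hxy => hs hxy)]
      congr 1
      ext j; simp
    rw [h3, ← Finset.sum_add_distrib]
    refine Finset.sum_congr rfl fun j _ => ?_
    by_cases hj : j ∈ Set.range s
    · obtain ⟨r', rfl⟩ := hj
      simp [hxe2]
    · rw [hxe1 j hj, if_neg hj]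
      field_simp
      simp
  have hu : ∀ r, MvPolynomial.eval e (u r) = c (s r) := by
    have h4 : (fun r => MvPolynomial.eval e (u r)) =
        - ((A'.submatrix id s).adjugate.mulVec (A'.mulVec xe)) := by
      ext r
      simp only [u, Pi.neg_apply, map_neg]
      rw [RingHom.map_mulVec, ← hmapS, ← hmapA]
      congr 1
      have h5 : (S.map (MvPolynomial.eval e)).adjugate = S.adjugate.map (MvPolynomial.eval e) :=
        (RingHom.map_adjugate (MvPolynomial.eval e) S).symm
      rw [h5]
      have h7 : (MvPolynomial.eval e ∘ (A.map ι).mulVec Xe) =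
          ((A.map ι).map (MvPolynomial.eval e)).mulVec xe := by
        ext r'
        simp only [Function.comp]
        rw [RingHom.map_mulVec]
        rfl
      rw [h7]
    have h6 : D • (fun r => MvPolynomial.eval e (u r)) = D • (c ∘ s) := by
      rw [h4, smul_neg, ← Matrix.mulVec_smul, hb, Matrix.mulVec_neg, neg_neg,
        Matrix.mulVec_mulVec, Matrix.adjugate_mul, Matrix.smul_mulVec, Matrix.one_mulVec]
    intro r
    have := congrFun h6 r
    simpa [hD] using this
  have hg : ∀ j, MvPolynomial.eval e (g j) = c j := by
    intro j
    simp only [g, map_add, map_mul]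
    have hdet : MvPolynomial.eval e S.det = D := by
      rw [RingHom.map_det, hDdef, ← hmapS]; rfl
    rw [hdet]
    change D * xe j + _ = _
    by_cases hj : j ∈ Set.range s
    · obtain ⟨r', rfl⟩ := hj
      rw [hs.extend_apply, hu, hxe2]; simp
    · rw [hxe1 j hj, Function.extend_apply' _ _ _ (by simpa using hj)]
      simp
      field_simp
  have := congrArg (MvPolynomial.eval e) hQ0
  rw [map_zero] at this
  rw [← this, MvPolynomial.aeval_def, MvPolynomial.eval₂_eq', MvPolynomial.eval_eq']
  simp [hg]



lemma aux_univ (P : Polynomial ℝ) (k : ℕ)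
    (h : (fun s : ℝ => P.eval s) =O[𝓝[≠] 0] fun s => s ^ (k + 1)) : ∀ m ≤ k, P.coeff m = 0 := by
  have key : ∀ (k : ℕ) (P : Polynomial ℝ),
      ((fun s : ℝ => P.eval s) =O[𝓝[≠] 0] fun s => s ^ (k + 1)) → P.coeff 0 = 0 := by
    intro k P h
    have h1 : Filter.Tendsto (fun s : ℝ => s ^ (k + 1)) (𝓝[≠] 0) (𝓝 0) := by
      have : Filter.Tendsto (fun s : ℝ => s ^ (k + 1)) (𝓝 0) (𝓝 (0 ^ (k+1))) :=
        (continuous_pow (k+1)).tendsto 0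
      simpa using this.mono_left nhdsWithin_le_nhds
    have h2 := h.trans_tendsto h1
    have h3 : Filter.Tendsto (fun s : ℝ => P.eval s) (𝓝[≠] 0) (𝓝 (P.eval 0)) :=
      (P.continuous.tendsto 0).mono_left nhdsWithin_le_nhds
    rw [Polynomial.coeff_zero_eq_eval_zero]
    exact tendsto_nhds_unique h3 h2
  induction k generalizing P with
  | zero =>
    intro m hm
    obtain rfl : m = 0 := by omega
    exact key 0 P h
  | succ k ih =>
    intro m hm
    have h0 := key _ P h
    rcases m with _ | m
    · exact h0
    have hP := P.divX_mul_X_add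
    rw [h0, map_zero, add_zero] at hP
    have : (fun s : ℝ => P.divX.eval s) =O[𝓝[≠] 0] fun s => s ^ (k + 1) := by
      obtain ⟨C, hC⟩ := h.bound
      refine Asymptotics.IsBigO.of_bound C ?_
      filter_upwards [hC, self_mem_nhdsWithin] with s hs hs0
      have hs0 : s ≠ 0 := hs0
      rw [← hP] at hs
      simp only [Polynomial.eval_mul, Polynomial.eval_X, norm_mul, norm_pow] at hs ⊢
      have : 0 < ‖s‖ := norm_pos_iff.mpr hs0
      rw [pow_succ _ (k+1), ← mul_assoc] at hs
      exact le_of_mul_le_mul_right hs this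
    have := ih P.divX this m (by omega)
    rwa [Polynomial.coeff_divX] at this

lemma aux_fact1 {ι : Type} [Fintype ι] (q : MvPolynomial ι ℝ) (k : ℕ)
    (h : (fun t : ι → ℝ => MvPolynomial.eval t q) =O[𝓝 0] fun t => ‖t‖ ^ (k + 1)) :
    ∀ γ : ι →₀ ℕ, γ.degree ≤ k → q.coeff γ = 0 := by
  intro γ hγ
  have hz : MvPolynomial.homogeneousComponent γ.degree q = 0 := by
    apply MvPolynomial.funext
    intro t
    let P : Polynomial ℝ := ∑ m ∈ Finset.range (q.totalDegree + 1),
      Polynomial.C (MvPolynomial.eval t (MvPolynomial.homogeneousComponent m q)) * Polynomial.X ^ m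
    have hP : ∀ s : ℝ, P.eval s = MvPolynomial.eval (s • t) q := by
      intro s
      conv_rhs => rw [← MvPolynomial.sum_homogeneousComponent q]
      simp only [P, Polynomial.eval_finsetSum, map_sum]
      refine Finset.sum_congr rfl fun m _ => ?_
      have hh := MvPolynomial.homogeneousComponent_isHomogeneous m q
      rw [MvPolynomial.eval_eq', MvPolynomial.eval_eq', Polynomial.eval_mul, Polynomial.eval_C,
        Polynomial.eval_pow, Polynomial.eval_X, Finset.sum_mul]
      refine Finset.sum_congr rfl fun d hd => ?_
      have hdm : ∑ i, d i = m := by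
        rw [← Finsupp.degree_eq_sum, Finsupp.degree_eq_weight_one]
        exact hh (MvPolynomial.mem_support_iff.mp hd)
      simp only [Pi.smul_apply, smul_eq_mul, mul_pow, Finset.prod_mul_distrib]
      rw [Finset.prod_pow_eq_pow_sum, hdm]
      ring
    have hO : (fun s : ℝ => P.eval s) =O[𝓝[≠] 0] fun s => s ^ (k + 1) := by
      have ht : Filter.Tendsto (fun s : ℝ => s • t) (𝓝[≠] 0) (𝓝 0) := by
        have : Filter.Tendsto (fun s : ℝ => s • t) (𝓝 0) (𝓝 ((0:ℝ) • t)) :=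
          (by fun_prop : Continuous fun s : ℝ => s • t).tendsto 0
        simpa using this.mono_left nhdsWithin_le_nhds
      have h1 := h.comp_tendsto ht
      refine (h1.congr_left (fun s => (hP s).symm)).trans ?_
      refine Asymptotics.IsBigO.of_bound (‖t‖ ^ (k+1)) (Filter.Eventually.of_forall fun s => ?_)
      simp [norm_smul, mul_pow, mul_comm]
    have := aux_univ P k hO γ.degree hγ
    simp only [P, Polynomial.finsetSum_coeff, Polynomial.coeff_C_mul_X_pow] at this
    rw [map_zero]
    by_cases hd : γ.degree < q.totalDegree + 1
    · simpa [Finset.sum_ite_eq, hd] using this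
    · rw [MvPolynomial.homogeneousComponent_eq_zero _ _ (by omega)]
      simp
  have := MvPolynomial.coeff_homogeneousComponent γ.degree q γ
  rw [hz] at this
  simpa using this.symm

lemma aux_fact2 {ι : Type} [Fintype ι] (q : MvPolynomial ι ℝ) (k : ℕ)
    (h : ∀ γ : ι →₀ ℕ, γ.degree ≤ k → q.coeff γ = 0) :
    (fun t : ι → ℝ => MvPolynomial.eval t q) =O[𝓝 0] fun t => ‖t‖ ^ (k + 1) := by
  have : (fun t : ι → ℝ => MvPolynomial.eval t q) =
      fun t => ∑ d ∈ q.support, q.coeff d * ∏ i, t i ^ d i := by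
    ext t; rw [MvPolynomial.eval_eq']
  rw [this]
  refine Asymptotics.IsBigO.fun_sum fun d hd => ?_
  have hdeg : k + 1 ≤ d.degree := by
    by_contra hlt
    exact (MvPolynomial.mem_support_iff.mp hd) (h d (by omega))
  refine Asymptotics.IsBigO.of_bound ‖q.coeff d‖ ?_
  filter_upwards [Metric.ball_mem_nhds (0 : ι → ℝ) one_pos] with t ht
  have ht1 : ‖t‖ ≤ 1 := by simpa using (mem_ball_zero_iff.mp ht).le
  rw [norm_mul]
  refine mul_le_mul_of_nonneg_left ?_ (norm_nonneg _)
  rw [norm_prod]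
  calc ∏ i, ‖t i ^ d i‖ ≤ ∏ i, ‖t‖ ^ d i := by
        refine Finset.prod_le_prod (fun i _ => norm_nonneg _) fun i _ => ?_
        rw [norm_pow]
        exact pow_le_pow_left₀ (norm_nonneg _) (norm_le_pi_norm t i) _
    _ = ‖t‖ ^ d.degree := by rw [Finset.prod_pow_eq_pow_sum, Finsupp.degree_eq_sum]
    _ ≤ ‖t‖ ^ (k+1) := pow_le_pow_of_le_one (norm_nonneg _) ht1 hdeg
    _ = ‖‖t‖ ^ (k+1)‖ := by simp


/-- Number of occurrences of `y` among the values of `g`. -/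
def auxCnt {Y : Type} [DecidableEq Y] {m : ℕ} (g : Fin m → Y) (y : Y) : ℕ :=
  (Finset.univ.filter fun i => g i = y).card

lemma auxCnt_sum {Y : Type} [DecidableEq Y] [Fintype Y] {m : ℕ} (g : Fin m → Y) :
    ∑ y, auxCnt g y = m := by
  have := Finset.card_eq_sum_card_fiberwise (s := Finset.univ) (t := Finset.univ) (f := g)
    (by intro x _; simp)
  simpa [auxCnt] using this.symm

lemma auxCnt_prod {Y R : Type} [DecidableEq Y] [Fintype Y] [CommMonoid R] {m : ℕ} (g : Fin m → Y)
    (x : Y → R) : ∏ i, x (g i) = ∏ y, x y ^ auxCnt g y := by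
  rw [← Finset.prod_fiberwise (s := Finset.univ) (g := g)]
  refine Finset.prod_congr rfl fun y _ => ?_
  rw [auxCnt, Finset.prod_congr rfl (g := fun _ => x y)]
  · simp
  · intro i hi
    simp at hi
    rw [hi]

lemma auxCnt_get {Y : Type} [DecidableEq Y] (L : List Y) (y : Y) :
    auxCnt (fun j => L.get j) y = L.count y := by
  have := Fin.card_filter_univ_eq_vector_get_eq_count y (⟨L, rfl⟩ : List.Vector Y L.length)
  simp only [List.Vector.toList] at this
  rw [← this]
  rfl

lemma aux_exists_equiv {Y : Type} [DecidableEq Y] {m m' : ℕ} (g : Fin m → Y) (g' : Fin m' → Y)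
    (h : ∀ y, auxCnt g y = auxCnt g' y) : ∃ σ : Fin m ≃ Fin m', ∀ i, g' (σ i) = g i := by
  have he : ∀ y, Nonempty ({i // g i = y} ≃ {i // g' i = y}) := by
    intro y
    rw [← Fintype.card_eq, Fintype.card_subtype, Fintype.card_subtype]
    exact h y
  exact ⟨Equiv.ofFiberEquiv (fun y => (he y).some), fun i => Equiv.ofFiberEquiv_map _ i⟩

lemma aux_count_flat {Y : Type} [DecidableEq Y] (L : List Y) (β : Y → ℕ) (y : Y) (hnd : L.Nodup)
    (hmem : y ∈ L) : (L.flatMap fun x => List.replicate (β x) x).count y = β y := by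
  rw [List.count_flatMap]
  have : (List.map (List.count y ∘ fun x => List.replicate (β x) x) L)
      = L.map (fun x => if x = y then β y else 0) := by
    refine List.map_congr_left fun x _ => ?_
    simp only [Function.comp, List.count_replicate, beq_iff_eq]
    split_ifs with h
    · rw [h]
    · rfl
  rw [this]
  have h2 := List.sum_toFinset (fun x => if x = y then β y else 0) hnd
  rw [← h2, Finset.sum_ite_eq']
  simp [hmem]

lemma aux_count_rmultiList (n : ℕ) (β : Fin n × Bool → ℕ) (y : Fin n × Bool) :
    @List.count _ instBEqOfDecidableEq y (rmultiList n β) = β y := by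
  have hnd : (((List.finRange n).flatMap fun i => [(i, false), (i, true)])).Nodup := by
    rw [List.nodup_flatMap]
    refine ⟨by simp, ?_⟩
    refine (List.nodup_finRange n).imp ?_
    intro a b hab
    simp [Function.onFun, List.disjoint_left, hab]
  have hmem : y ∈ (((List.finRange n).flatMap fun i => [(i, false), (i, true)])) := by
    obtain ⟨i, b⟩ := y
    simp only [List.mem_flatMap]
    exact ⟨i, List.mem_finRange i, by cases b <;> simp⟩
  exact aux_count_flat _ β y hnd hmem

lemma aux_rmderiv {n m : ℕ} (f : Cn n → ℝ) (hf : AnalyticAt ℝ f 0) (g : Fin m → Fin n × Bool) :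
    iteratedFDeriv ℝ m f 0 (fun i => rbasis n (g i)) = rmderiv (auxCnt g) f 0 := by
  unfold rmderiv
  obtain ⟨σ, hσ⟩ := aux_exists_equiv g (fun j => (rmultiList n (auxCnt g)).get j) (by
    intro y; rw [auxCnt_get, aux_count_rmultiList])
  generalize rmultiList n (auxCnt g) = L at *
  have hm : m = L.length := by simpa using Fintype.card_congr σ
  subst hm
  rw [← hf.contDiffAt.iteratedFDeriv_comp_perm (fun j => rbasis n (L.get j)) σ]
  congr 1
  ext1 i
  simp only [Function.comp]
  rw [hσ]

lemma aux_multi {𝕜 E F Y : Type} [NontriviallyNormedField 𝕜] [NormedAddCommGroup E]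
    [NormedSpace 𝕜 E] [NormedAddCommGroup F] [NormedSpace 𝕜 F] [Fintype Y] [DecidableEq Y]
    (e : Y → E) (x : E) (c : Y → 𝕜) (hx : x = ∑ y, c y • e y) {m : ℕ}
    (p : ContinuousMultilinearMap 𝕜 (fun _ : Fin m => E) F) :
    p (fun _ => x) = ∑ g : Fin m → Y, (∏ y, c y ^ auxCnt g y) • p (fun i => e (g i)) := by
  have h1 := p.toMultilinearMap.map_sum (fun (_ : Fin m) y => c y • e y)
  simp only [← hx] at h1
  refine h1.trans (Finset.sum_congr rfl fun g _ => ?_)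
  rw [← auxCnt_prod g c]
  exact p.toMultilinearMap.map_smul_univ (fun i => c (g i)) (fun i => e (g i))

/-- Real coordinates. -/
def auxRc {n : ℕ} (x : Cn n) (y : Fin n × Bool) : ℝ := if y.2 then (x y.1).im else (x y.1).re

lemma auxRc_sum {n : ℕ} (x : Cn n) : x = ∑ y, auxRc x y • rbasis n y := by
  ext j
  rw [Fintype.sum_prod_type]
  simp [auxRc, rbasis]
  simp only [Pi.single_apply, mul_ite, mul_zero, mul_one, Finset.sum_add_distrib,
    Finset.sum_ite_eq, Finset.mem_univ, if_true]
  rw [add_comm, Complex.re_add_im]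

/-- weights -/
def auxW (n k : ℕ) (β : MIdx n k) : ℝ :=
  (∑ m ∈ Finset.range (k + 1),
    ((Finset.univ.filter fun g : Fin m → Fin n × Bool => auxCnt g = fun y => (β.1 y : ℕ)).card : ℝ)
      / (m.factorial : ℝ)) * (∏ y, (Nat.factorial (β.1 y : ℕ) : ℝ))

lemma auxW_ne {n k : ℕ} (β : MIdx n k) : auxW n k β ≠ 0 := by
  apply ne_of_gt
  refine mul_pos ?_ (Finset.prod_pos fun y _ => by positivity)
  set b : Fin n × Bool → ℕ := fun y => (β.1 y : ℕ) with hb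
  have hcnt : auxCnt (fun j => (rmultiList n b).get j) = b := by
    ext y; rw [auxCnt_get, aux_count_rmultiList]
  have hlen : (rmultiList n b).length = ∑ y, b y := by
    exact (auxCnt_sum (fun j => (rmultiList n b).get j)).symm.trans (by rw [hcnt])
  refine Finset.sum_pos' (fun m _ => by positivity) ⟨(rmultiList n b).length, ?_, ?_⟩
  · rw [Finset.mem_range, hlen]
    have := β.2.2
    simp only [hb]
    omega
  · have : 0 < (Finset.univ.filter fun g : Fin (rmultiList n b).length → Fin n × Bool =>
        auxCnt g = b).card := Finset.card_pos.mpr ⟨_, by simpa using hcnt⟩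
    positivity

lemma aux_taylor_real {n k : ℕ} (f : Cn n → ℝ) (hf : AnalyticAt ℝ f 0) (h0 : f 0 = 0) :
    (fun x => f x - ∑ β : MIdx n k, auxW n k β *
      (rmderiv (fun y => (β.1 y : ℕ)) f 0 / (∏ y, Nat.factorial (β.1 y : ℕ) : ℝ)) *
      ∏ y, auxRc x y ^ (β.1 y : ℕ)) =O[𝓝 0] fun x => ‖x‖ ^ (k + 1) := by
  obtain ⟨p, hp⟩ := hf
  have hf : AnalyticAt ℝ f 0 := ⟨p, hp⟩
  have hO := hp.isBigO_sub_partialSum_pow (k + 1)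
  refine hO.congr_left fun x => ?_
  rw [zero_add]
  congr 1
  have hterm : ∀ m, p m (fun _ => x) = (m.factorial : ℝ)⁻¹ * ∑ g : Fin m → Fin n × Bool,
      (∏ y, auxRc x y ^ auxCnt g y) * rmderiv (auxCnt g) f 0 := by
    intro m
    obtain ⟨r, hr⟩ := hp
    have h1 := hr.factorial_smul x m
    have h2 := aux_multi (rbasis n) x (auxRc x) (auxRc_sum x) (iteratedFDeriv ℝ m f 0)
    simp only [aux_rmderiv f hf, smul_eq_mul] at h2
    rw [← h2, ← h1]
    have : (m.factorial : ℝ) ≠ 0 := by positivity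
    simp [this]
  have hterm2 : ∀ m ∈ Finset.range (k + 1), p m (fun _ => x) = (m.factorial : ℝ)⁻¹ *
      ∑ β : MIdx n k, ((Finset.univ.filter fun g : Fin m → Fin n × Bool =>
        auxCnt g = fun y => (β.1 y : ℕ)).card : ℝ) *
        ((∏ y, auxRc x y ^ (β.1 y : ℕ)) * rmderiv (fun y => (β.1 y : ℕ)) f 0) := by
    intro m hm
    have hm : m ≤ k := by simpa [Nat.lt_succ_iff] using hm
    rcases Nat.eq_zero_or_pos m with rfl | hpos
    · have e1 : p 0 (fun _ => x) = 0 := by rw [← h0]; exact hp.coeff_zero _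
      rw [e1, eq_comm, mul_eq_zero]
      right
      refine Finset.sum_eq_zero fun β _ => ?_
      rw [Finset.card_eq_zero.mpr]
      · simp
      · rw [Finset.filter_eq_empty_iff]
        intro g _ hg
        have h2 := auxCnt_sum g
        rw [hg] at h2
        have := β.2.1
        simp only at h2
        omega
    · rw [hterm]
      congr 1
      simp only [Finset.card_filter, Nat.cast_sum, Finset.sum_mul]
      rw [Finset.sum_comm]
      refine Finset.sum_congr rfl fun g _ => ?_
      have hsum := auxCnt_sum g
      have hle : ∀ y, auxCnt g y < k + 1 := fun y => by
        have := Finset.single_le_sum (f := auxCnt g) (fun i _ => Nat.zero_le _) (Finset.mem_univ y)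
        omega
      let β : MIdx n k := ⟨fun y => ⟨auxCnt g y, hle y⟩, by simp only [hsum]; omega⟩
      rw [Finset.sum_eq_single β]
      · simp [β]
      · intro b _ hb
        rw [if_neg]
        · simp
        · intro hg
          apply hb
          ext y
          simp [β, hg]
      · simp
  rw [FormalMultilinearSeries.partialSum, Finset.sum_congr rfl hterm2]
  simp only [Finset.mul_sum]
  rw [Finset.sum_comm]
  refine Finset.sum_congr rfl fun β _ => ?_
  have hne : (∏ y, (Nat.factorial (β.1 y : ℕ) : ℝ)) ≠ 0 :=
    Finset.prod_ne_zero_iff.mpr fun y _ => by positivity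
  rw [auxW]
  field_simp
  simp only [Finset.mul_sum]
  refine Finset.sum_congr rfl fun m _ => ?_
  have : (m.factorial : ℝ) ≠ 0 := by positivity
  field_simp


/-- Real coordinates as continuous linear maps. -/
def auxRcL (n : ℕ) (y : Fin n × Bool) : Cn n →L[ℝ] ℝ :=
  if y.2 then Complex.imCLM.comp ((EuclideanSpace.proj y.1 : Cn n →L[ℂ] ℂ).restrictScalars ℝ)
  else Complex.reCLM.comp ((EuclideanSpace.proj y.1 : Cn n →L[ℂ] ℂ).restrictScalars ℝ)

lemma auxRcL_apply {n : ℕ} (y : Fin n × Bool) (x : Cn n) : auxRcL n y x = auxRc x y := by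
  unfold auxRcL auxRc
  split_ifs <;> simp

lemma aux_choose {n : ℕ} (D : (Fin 3 → ℝ) →L[ℝ] Cn n) (hD : Function.Injective D) :
    ∃ I : Fin 3 → Fin n × Bool, Function.Injective I ∧
      ∀ t, (∀ i, auxRc (D t) (I i) = 0) → t = 0 := by
  let l : Fin n × Bool → Module.Dual ℝ (Fin 3 → ℝ) := fun y =>
    ((auxRcL n y).comp D).toLinearMap
  have hl : ∀ y t, l y t = auxRc (D t) y := fun y t => auxRcL_apply y (D t)
  obtain ⟨f, hf1, hf2, hf3⟩ := Submodule.exists_fun_fin_finrank_span_eq ℝ (Set.range l)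
  have hr : Module.finrank ℝ (Submodule.span ℝ (Set.range l)) ≤ 3 := by
    refine (Submodule.finrank_le _).trans ?_
    rw [Subspace.dual_finrank_eq]; simp
  generalize Module.finrank ℝ (Submodule.span ℝ (Set.range l)) = r at *
  have hker : ∀ t, (∀ i, f i t = 0) → t = 0 := by
    intro t ht
    have h1 : ∀ φ ∈ Submodule.span ℝ (Set.range f), φ t = 0 := by
      intro φ hφ
      induction hφ using Submodule.span_induction with
      | mem x hx => obtain ⟨i, rfl⟩ := hx; exact ht i
      | zero => simp
      | add x y _ _ hx hy => simp [hx, hy]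
      | smul a x _ hx => simp [hx]
    apply hD
    rw [map_zero, auxRc_sum (D t)]
    refine Finset.sum_eq_zero fun y _ => ?_
    rw [← hl, h1, zero_smul]
    rw [hf2]
    exact Submodule.subset_span ⟨y, rfl⟩
  have hr2 : 3 ≤ r := by
    have hinj : Function.Injective (LinearMap.pi f) := by
      rw [← LinearMap.ker_eq_bot, LinearMap.ker_eq_bot']
      intro t ht
      exact hker t fun i => congrFun ht i
    simpa using LinearMap.finrank_le_finrank_of_injective hinj
  obtain rfl : r = 3 := le_antisymm hr hr2
  choose I hI using hf1
  refine ⟨I, ?_, ?_⟩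
  · intro i j hij
    apply hf3.injective
    rw [← hI, ← hI, hij]
  · intro t ht
    refine hker t fun i => ?_
    rw [← hI, hl, ht]

lemma aux_analytic {Y : Type} [Fintype Y] (P : MvPolynomial Y ℝ) (z : Y → ℝ) :
    AnalyticAt ℝ (fun x : Y → ℝ => MvPolynomial.eval x P) z := by
  have := AnalyticAt.aeval_mvPolynomial (𝕜 := ℝ) (f := fun x : Y → ℝ => x) (z := z)
    (fun i => (ContinuousLinearMap.proj (R := ℝ) (φ := fun _ : Y => ℝ) i).analyticAt z) P
  simpa [MvPolynomial.aeval_eq_eval] using this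

lemma aux_lip {Y : Type} [Fintype Y] (P : MvPolynomial Y ℝ) {E : Type} [NormedAddCommGroup E]
    (u v : E → Y → ℝ) (hu : Filter.Tendsto u (𝓝 0) (𝓝 0)) (hv : Filter.Tendsto v (𝓝 0) (𝓝 0))
    (h : E → ℝ) (huv : ∀ y, (fun t => u t y - v t y) =O[𝓝 0] h) :
    (fun t => MvPolynomial.eval (u t) P - MvPolynomial.eval (v t) P) =O[𝓝 0] h := by
  have hA := aux_analytic P 0
  have h1 := hA.hasStrictFDerivAt.isBigO_sub
  have h2 : Filter.Tendsto (fun t => (u t, v t)) (𝓝 0) (𝓝 ((0, 0) : (Y → ℝ) × (Y → ℝ))) :=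
    hu.prodMk_nhds hv
  refine (h1.comp_tendsto h2).trans ?_
  exact Asymptotics.isBigO_pi.mpr huv

/-- Row indices. -/
abbrev AuxR (k : ℕ) : Type :=
  {γ : Fin 3 → Fin (k + 1) // 1 ≤ ∑ x, (γ x : ℕ) ∧ ∑ x, (γ x : ℕ) ≤ k}

def auxF {k : ℕ} (γ : AuxR k) : Fin 3 →₀ ℕ := Finsupp.equivFunOnFinite.symm fun i => (γ.1 i : ℕ)

lemma auxF_deg {k : ℕ} (γ : AuxR k) : (auxF γ).degree = ∑ x, (γ.1 x : ℕ) := by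
  rw [Finsupp.degree_eq_sum]; rfl

lemma auxF_surj {k : ℕ} (d : Fin 3 →₀ ℕ) (h1 : 1 ≤ d.degree) (h2 : d.degree ≤ k) :
    ∃ γ : AuxR k, auxF γ = d := by
  rw [Finsupp.degree_eq_sum] at h1 h2
  have hle : ∀ y, d y < k + 1 := fun y => by
    have := Finset.single_le_sum (f := d) (fun i _ => Nat.zero_le _) (Finset.mem_univ y)
    omega
  exact ⟨⟨fun i => ⟨d i, hle i⟩, h1, h2⟩, by ext i; rfl⟩

lemma auxF_inj {k : ℕ} : Function.Injective (auxF : AuxR k → _) := by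
  intro a b h
  ext i
  exact DFunLike.congr_fun h i

/-- Extend an index by zero along `I`. -/
def auxExt {n k : ℕ} (I : Fin 3 ↪ Fin n × Bool) (γ : AuxR k) : MIdx n k :=
  ⟨Function.extend I γ.1 0, by
    have : ∑ y, ((Function.extend I γ.1 0 y : Fin (k+1)) : ℕ) = ∑ i, (γ.1 i : ℕ) := by
      rw [← Finset.sum_subset (Finset.subset_univ (Finset.univ.map I))]
      · simp [I.injective.extend_apply]
      · intro y _ hy
        rw [Function.extend_apply']
        · simp
        · simpa using hy
    rw [this]
    exact γ.2⟩

lemma auxExt_inj {n k : ℕ} (I : Fin 3 ↪ Fin n × Bool) :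
    Function.Injective (auxExt I : AuxR k → MIdx n k) := by
  intro a b h
  have h1 : Function.extend I a.1 0 = Function.extend I b.1 0 := congrArg Subtype.val h
  ext i
  have := congrFun h1 (I i)
  rw [I.injective.extend_apply, I.injective.extend_apply] at this
  rw [this]

lemma auxExt_prod {n k : ℕ} {S : Type} [CommMonoid S] (I : Fin 3 ↪ Fin n × Bool) (γ : AuxR k)
    (x : Fin n × Bool → S) :
    ∏ y, x y ^ (((auxExt I γ).1 y : Fin (k+1)) : ℕ) = ∏ i, x (I i) ^ (γ.1 i : ℕ) := by
  simp only [auxExt]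
  rw [← Finset.prod_subset (Finset.subset_univ (Finset.univ.map I))]
  · simp [I.injective.extend_apply]
  · intro y _ hy
    rw [Function.extend_apply']
    · simp
    · simpa using hy

/-- The evaluated matrix. -/
def auxB {n : ℕ} (k : ℕ) (G : Fin n × Bool → MvPolynomial (Fin 3) ℝ) :
    Matrix (AuxR k) (MIdx n k) ℝ :=
  fun γ β => auxW n k β * (∏ y, G y ^ (β.1 y : ℕ)).coeff (auxF γ)

lemma aux_G0 {n k : ℕ} (G : Fin n × Bool → MvPolynomial (Fin 3) ℝ) (F : (Fin 3 → ℝ) → Cn n)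
    (hF0 : F 0 = 0)
    (hG : ∀ y, (fun t => MvPolynomial.eval t (G y) - auxRc (F t) y) =O[𝓝 0]
      fun t => ‖t‖ ^ (k + 1))
    (y : Fin n × Bool) : MvPolynomial.eval 0 (G y) = 0 := by
  have := (hG y).eq_zero_imp
  have := this.self_of_nhds (by simp)
  rw [hF0] at this
  simpa [auxRc] using this

lemma aux_Gt {n k : ℕ} (G : Fin n × Bool → MvPolynomial (Fin 3) ℝ) (F : (Fin 3 → ℝ) → Cn n)
    (hF0 : F 0 = 0)
    (hG : ∀ y, (fun t => MvPolynomial.eval t (G y) - auxRc (F t) y) =O[𝓝 0]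
      fun t => ‖t‖ ^ (k + 1)) : Filter.Tendsto (fun (t : Fin 3 → ℝ) y => MvPolynomial.eval t (G y)) (𝓝 0) (𝓝 0) := by
  rw [tendsto_pi_nhds]
  intro y
  have := (MvPolynomial.continuous_eval (G y)).tendsto 0
  rwa [aux_G0 G F hF0 hG] at this

lemma aux_Ft {n : ℕ} (F : (Fin 3 → ℝ) → Cn n)
    (hF0 : F 0 = 0) (D : (Fin 3 → ℝ) →L[ℝ] Cn n) (hFD : HasFDerivAt F D 0) : Filter.Tendsto (fun (t : Fin 3 → ℝ) y => auxRc (F t) y) (𝓝 0) (𝓝 0) := by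
  rw [tendsto_pi_nhds]
  intro y
  have h1 : ContinuousAt (fun t => auxRcL n y (F t)) 0 :=
    (auxRcL n y).continuous.continuousAt.comp hFD.continuousAt
  have h2 := h1.tendsto
  simp only [hF0, map_zero, auxRcL_apply] at h2
  exact h2

lemma aux_core1 {n k : ℕ} (G : Fin n × Bool → MvPolynomial (Fin 3) ℝ) (F : (Fin 3 → ℝ) → Cn n)
    (hF0 : F 0 = 0) (D : (Fin 3 → ℝ) →L[ℝ] Cn n) (hFD : HasFDerivAt F D 0)
    (hG : ∀ y, (fun t => MvPolynomial.eval t (G y) - auxRc (F t) y) =O[𝓝 0]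
      fun t => ‖t‖ ^ (k + 1))
    (ρ : Cn n → ℝ) (hρ : AnalyticAt ℝ ρ 0) (hρ0 : ρ 0 = 0)
    (hz : ∀ᶠ t in 𝓝 0, ρ (F t) = 0) :
    (auxB k G).mulVec (fun β => rmderiv (fun y => (β.1 y : ℕ)) ρ 0 /
      (∏ y, Nat.factorial (β.1 y : ℕ) : ℝ)) = 0 := by
  set c : MIdx n k → ℝ := fun β => rmderiv (fun y => (β.1 y : ℕ)) ρ 0 /
      (∏ y, Nat.factorial (β.1 y : ℕ) : ℝ) with hc
  let T : MvPolynomial (Fin n × Bool) ℝ :=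
    ∑ β, MvPolynomial.C (auxW n k β * c β) * ∏ y, MvPolynomial.X y ^ (β.1 y : ℕ)
  let H : MvPolynomial (Fin 3) ℝ :=
    ∑ β, MvPolynomial.C (auxW n k β * c β) * ∏ y, G y ^ (β.1 y : ℕ)
  have hH : ∀ t, MvPolynomial.eval t H =
      MvPolynomial.eval (fun y => MvPolynomial.eval t (G y)) T := by
    intro t; simp [H, T]
  have hT := aux_taylor_real (k := k) ρ hρ hρ0
  have hFt : Filter.Tendsto F (𝓝 0) (𝓝 0) := by
    have := hFD.continuousAt.tendsto; rwa [hF0] at this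
  have hFO : F =O[𝓝 0] fun t => t := by
    have := hFD.isBigO_sub; simpa [hF0] using this
  have h1 : (fun t => MvPolynomial.eval (fun y => auxRc (F t) y) T) =O[𝓝 0]
      fun t => ‖t‖ ^ (k + 1) := by
    have h2 := (hT.comp_tendsto hFt).trans (hFO.norm_norm.pow (k + 1))
    refine h2.neg_left.congr' ?_ (Filter.EventuallyEq.refl _ _)
    filter_upwards [hz] with t ht
    simp [T, ht, hc]
  have h3 : (fun t => MvPolynomial.eval t H) =O[𝓝 0] fun t => ‖t‖ ^ (k + 1) := by
    have h4 := aux_lip T _ _ (aux_Gt G F hF0 hG) (aux_Ft F hF0 D hFD) _ hG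
    refine (h4.add h1).congr_left fun t => ?_
    rw [hH]; ring
  have h5 := aux_fact1 H k h3
  ext γ
  have h6 := h5 (auxF γ) (by rw [auxF_deg]; exact γ.2.2)
  simp only [Pi.zero_apply, ← h6, H, MvPolynomial.coeff_sum, MvPolynomial.coeff_C_mul,
    Matrix.mulVec, dotProduct, auxB]
  refine Finset.sum_congr rfl fun β _ => ?_
  ring

lemma aux_core2 {n k : ℕ} (G : Fin n × Bool → MvPolynomial (Fin 3) ℝ) (F : (Fin 3 → ℝ) → Cn n)
    (hF0 : F 0 = 0) (D : (Fin 3 → ℝ) →L[ℝ] Cn n) (hFD : HasFDerivAt F D 0)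
    (hG : ∀ y, (fun t => MvPolynomial.eval t (G y) - auxRc (F t) y) =O[𝓝 0]
      fun t => ‖t‖ ^ (k + 1))
    (hk : 1 ≤ k) (hD : Function.Injective D) :
    ∃ I : Fin 3 ↪ Fin n × Bool, ((auxB k G).submatrix id (auxExt I)).det ≠ 0 := by
  obtain ⟨I', hI', hI⟩ := aux_choose D hD
  let I : Fin 3 ↪ Fin n × Bool := ⟨I', hI'⟩
  refine ⟨I, fun hdet => ?_⟩
  obtain ⟨v, hv, hv0⟩ := Matrix.exists_mulVec_eq_zero_iff.mpr hdet
  let q : MvPolynomial (Fin 3) ℝ :=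
    ∑ γ : AuxR k, MvPolynomial.monomial (auxF γ) (auxW n k (auxExt I γ) * v γ)
  let H : MvPolynomial (Fin 3) ℝ :=
    ∑ γ : AuxR k, MvPolynomial.C (auxW n k (auxExt I γ) * v γ) *
      ∏ y, G y ^ ((auxExt I γ).1 y : ℕ)
  have hmon : ∀ (γ : AuxR k) (a : ℝ) (x : Fin 3 → ℝ),
      MvPolynomial.eval x (MvPolynomial.monomial (auxF γ) a) = a * ∏ i, x i ^ (γ.1 i : ℕ) := by
    intro γ a x
    rw [MvPolynomial.eval_monomial, Finsupp.prod_fintype]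
    · rfl
    · simp
  have hH : ∀ t, MvPolynomial.eval t H =
      MvPolynomial.eval (fun i => MvPolynomial.eval t (G (I i))) q := by
    intro t
    simp only [H, q, map_sum, hmon, auxExt_prod, map_mul, map_prod, map_pow, MvPolynomial.eval_C]
  have hcoef : ∀ d : Fin 3 →₀ ℕ, d.degree ≤ k → H.coeff d = 0 := by
    intro d hd
    rcases Nat.eq_zero_or_pos d.degree with h0 | hpos
    · have hd0 : d = 0 := (Finsupp.degree_eq_zero_iff d).mp h0
      have e1 : MvPolynomial.eval 0 H = 0 := by
        rw [hH]
        simp only [aux_G0 G F hF0 hG, q, map_sum, hmon]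
        refine Finset.sum_eq_zero fun γ _ => ?_
        rw [Finset.prod_pow_eq_pow_sum, zero_pow (by have := γ.2.1; omega), mul_zero]
      rw [hd0, ← MvPolynomial.constantCoeff_eq, ← e1, MvPolynomial.eval_zero]
    · obtain ⟨γ, rfl⟩ := auxF_surj d hpos hd
      have := congrFun hv0 γ
      simp only [Matrix.mulVec, dotProduct, Matrix.submatrix_apply, id, auxB,
        Pi.zero_apply] at this
      rw [← this]
      simp only [H, MvPolynomial.coeff_sum, MvPolynomial.coeff_C_mul]
      refine Finset.sum_congr rfl fun β _ => ?_
      ring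
  have hO1 := aux_fact2 H k hcoef
  let FI : (Fin 3 → ℝ) → (Fin 3 → ℝ) := fun t i => MvPolynomial.eval t (G (I i))
  let DI : (Fin 3 → ℝ) →L[ℝ] (Fin 3 → ℝ) :=
    ContinuousLinearMap.pi fun i => (auxRcL n (I i)).comp D
  have hFI : HasStrictFDerivAt FI DI 0 := by
    rw [hasStrictFDerivAt_pi']
    intro i
    have h1 : HasFDerivAt (fun t => auxRc (F t) (I i)) ((auxRcL n (I i)).comp D) 0 := by
      have := (auxRcL n (I i)).hasFDerivAt.comp (x := (0 : Fin 3 → ℝ)) hFD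
      simpa [Function.comp_def, auxRcL_apply] using this
    have h2 : HasFDerivAt (fun t => MvPolynomial.eval t (G (I i)) - auxRc (F t) (I i))
        (0 : (Fin 3 → ℝ) →L[ℝ] ℝ) 0 := by
      have := hG (I i)
      refine Asymptotics.IsBigO.hasFDerivAt (n := k + 1) ?_ (by omega)
      simpa using this
    have h3 := h1.add h2
    have h4 := (aux_analytic (G (I i)) 0).hasStrictFDerivAt
    have h5 : fderiv ℝ (fun x => MvPolynomial.eval x (G (I i))) 0 = (auxRcL n (I i)).comp D := by
      refine h4.hasFDerivAt.unique ?_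
      refine (h3.congr_of_eventuallyEq (Filter.Eventually.of_forall fun t => ?_)).congr_fderiv ?_
      · simp
      · simp
    rw [h5] at h4
    exact h4
  have hFI0 : FI 0 = 0 := by ext i; exact aux_G0 G F hF0 hG _
  have hO2 : (fun t => MvPolynomial.eval (FI t) q) =O[𝓝 0] fun t => ‖t‖ ^ (k + 1) :=
    hO1.congr_left fun t => hH t
  have hinj : Function.Injective DI.toLinearMap := by
    rw [← LinearMap.ker_eq_bot, LinearMap.ker_eq_bot']
    intro t ht
    refine hI t fun i => ?_
    have h1 : auxRcL n (I i) (D t) = 0 := congrFun ht i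
    rw [auxRcL_apply] at h1
    exact h1
  let DE : (Fin 3 → ℝ) ≃L[ℝ] (Fin 3 → ℝ) :=
    (LinearEquiv.ofInjectiveEndo DI.toLinearMap hinj).toContinuousLinearEquiv
  have hFE : HasStrictFDerivAt FI (DE : (Fin 3 → ℝ) →L[ℝ] (Fin 3 → ℝ)) 0 := by
    have h1 : (DE : (Fin 3 → ℝ) →L[ℝ] (Fin 3 → ℝ)) = DI := ContinuousLinearMap.ext fun t => rfl
    rw [h1]; exact hFI
  have hO3 : (fun x => MvPolynomial.eval x q) =O[𝓝 0] fun x => ‖x‖ ^ (k + 1) := by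
    have hr := hFE.eventually_right_inverse
    have hl := hFE.to_localInverse
    have h0 := hFE.localInverse_apply_image
    have ht := hFE.localInverse_tendsto
    rw [hFI0] at hr hl h0 ht
    have hLO : hFE.localInverse FI DE 0 =O[𝓝 0] fun t => t := by
      have := hl.hasFDerivAt.isBigO_sub; simpa [h0] using this
    refine ((hO2.comp_tendsto ht).trans (hLO.norm_norm.pow (k + 1))).congr' ?_
      (Filter.EventuallyEq.refl _ _)
    filter_upwards [hr] with x hx
    simp [hx]
  have hq := aux_fact1 q k hO3
  apply hv
  ext γ
  have h7 := hq (auxF γ) (by rw [auxF_deg]; exact γ.2.2)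
  simp only [q, MvPolynomial.coeff_sum, MvPolynomial.coeff_monomial] at h7
  rw [Finset.sum_eq_single γ] at h7
  · simpa [auxW_ne] using h7
  · intro b _ hb
    rw [if_neg]
    intro h
    exact hb (auxF_inj h)
  · simp


/-- Separately holomorphic and bounded on a bidisc. -/
structure AuxHol (R : ℝ) (h : ℂ → ℂ → ℂ) : Prop where
  h1 : ∀ w ∈ Metric.ball (0 : ℂ) R, DifferentiableOn ℂ (fun z => h z w) (Metric.ball 0 R)
  h2 : ∀ z ∈ Metric.ball (0 : ℂ) R, DifferentiableOn ℂ (fun w => h z w) (Metric.ball 0 R)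
  bd : ∃ M : ℝ, ∀ z ∈ Metric.ball (0 : ℂ) R, ∀ w ∈ Metric.ball (0 : ℂ) R, ‖h z w‖ ≤ M

lemma aux_dslope_bd {R M : ℝ} {f : ℂ → ℂ}
    (hf : DifferentiableOn ℂ f (Metric.ball 0 R)) (hM : ∀ z ∈ Metric.ball (0 : ℂ) R, ‖f z‖ ≤ M)
    (z : ℂ) (hz : z ∈ Metric.ball (0 : ℂ) R) : ‖dslope f 0 z‖ ≤ (2 * M) / R := by
  refine Complex.norm_dslope_le_div_of_mapsTo_ball hf ?_ hz
  intro x hx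
  have hR : 0 < R := Metric.pos_of_mem_ball hz
  have h1 := hM x hx
  have h2 := hM 0 (Metric.mem_ball_self hR)
  rw [Metric.mem_closedBall, dist_eq_norm]
  calc ‖f x - f 0‖ ≤ ‖f x‖ + ‖f 0‖ := norm_sub_le _ _
    _ ≤ 2 * M := by linarith

lemma AuxHol.step {R : ℝ} (hR : 0 < R) {h : ℂ → ℂ → ℂ} (hh : AuxHol R h) :
    AuxHol R (fun z w => dslope (fun z' => h z' w) 0 z) := by
  obtain ⟨h1, h2, M, hM⟩ := hh
  have hnhds : Metric.ball (0 : ℂ) R ∈ 𝓝 (0 : ℂ) := Metric.ball_mem_nhds _ hR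
  have h0 : (0 : ℂ) ∈ Metric.ball (0 : ℂ) R := Metric.mem_ball_self hR
  have hg1 : ∀ w ∈ Metric.ball (0 : ℂ) R,
      DifferentiableOn ℂ (dslope (fun z' => h z' w) 0) (Metric.ball 0 R) := fun w hw =>
    (Complex.differentiableOn_dslope hnhds).mpr (h1 w hw)
  have hgb : ∀ z ∈ Metric.ball (0 : ℂ) R, ∀ w ∈ Metric.ball (0 : ℂ) R,
      ‖dslope (fun z' => h z' w) 0 z‖ ≤ (2 * M) / R := fun z hz w hw =>
    aux_dslope_bd (h1 w hw) (fun z hz => hM z hz w hw) z hz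
  have hne : ∀ z ∈ Metric.ball (0 : ℂ) R, z ≠ 0 →
      DifferentiableOn ℂ (fun w => dslope (fun z' => h z' w) 0 z) (Metric.ball 0 R) := by
    intro z hz hz0
    simp only [dslope_of_ne _ hz0, slope_def_field]
    exact ((h2 z hz).sub (h2 0 h0)).div_const _
  refine ⟨hg1, fun z hz => ?_, _, hgb⟩
  by_cases hz0 : z = 0
  · subst hz0
    have hU : TendstoUniformlyOn (fun (z w : ℂ) => dslope (fun z' => h z' w) 0 z)
        (fun w => dslope (fun z' => h z' w) 0 0) (𝓝[≠] 0) (Metric.ball 0 R) := by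
      rw [Metric.tendstoUniformlyOn_iff]
      intro ε hε
      set K := 2 * ((2 * M) / R) / R with hK
      have hlim : Filter.Tendsto (fun z : ℂ => ‖z‖ * K) (𝓝[≠] 0) (𝓝 0) := by
        have : Filter.Tendsto (fun z : ℂ => ‖z‖ * K) (𝓝 0) (𝓝 (‖(0:ℂ)‖ * K)) :=
          (by fun_prop : Continuous fun z : ℂ => ‖z‖ * K).tendsto 0
        simpa using this.mono_left nhdsWithin_le_nhds
      filter_upwards [hlim.eventually (gt_mem_nhds hε), nhdsWithin_le_nhds hnhds] with z hzε hzR w hw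
      have e1 := sub_smul_dslope (dslope (fun z' => h z' w) 0) 0 z
      have e2 := aux_dslope_bd (hg1 w hw) (fun z hz => hgb z hz w hw) z hzR
      rw [dist_comm, dist_eq_norm, ← e1, sub_zero, norm_smul]
      exact lt_of_le_of_lt (mul_le_mul_of_nonneg_left e2 (norm_nonneg _)) hzε
    refine hU.tendstoLocallyUniformlyOn.differentiableOn ?_ Metric.isOpen_ball
    filter_upwards [self_mem_nhdsWithin, nhdsWithin_le_nhds hnhds] with z hz0 hzR
    exact hne z hzR hz0
  · exact hne z hz hz0

lemma AuxHol.expand {R : ℝ} (hR : 0 < R) (k : ℕ) {h : ℂ → ℂ → ℂ} (hh : AuxHol R h) :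
    ∃ (c : ℕ → ℂ → ℂ) (g : ℂ → ℂ → ℂ), (∀ i, DifferentiableOn ℂ (c i) (Metric.ball 0 R)) ∧
      AuxHol R g ∧ ∀ z w, h z w = ∑ i ∈ Finset.range k, z ^ i * c i w + z ^ k * g z w := by
  induction k with
  | zero => exact ⟨fun _ _ => 0, h, fun i => differentiableOn_const _, hh, by simp⟩
  | succ k ih =>
    obtain ⟨c, g, hc, hg, hcg⟩ := ih
    refine ⟨Function.update c k (g 0), _, ?_, hg.step hR, ?_⟩
    · intro i
      by_cases hi : i = k
      · subst hi
        rw [Function.update_self]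
        exact hg.h2 0 (Metric.mem_ball_self hR)
      · rw [Function.update_of_ne hi]; exact hc i
    · intro z w
      rw [hcg, Finset.sum_range_succ]
      have e1 : ∑ i ∈ Finset.range k, z ^ i * Function.update c k (g 0) i w
          = ∑ i ∈ Finset.range k, z ^ i * c i w := by
        refine Finset.sum_congr rfl fun i hi => ?_
        rw [Function.update_of_ne (by simp at hi; omega)]
      rw [e1, Function.update_self]
      have e2 := sub_smul_dslope (fun z' => g z' w) 0 z
      simp only [sub_zero, smul_eq_mul] at e2
      have e3 : g z w = g 0 w + z * dslope (fun z' => g z' w) 0 z := by rw [e2]; ring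
      conv_lhs => rw [e3]
      ring

lemma aux_taylor1 {R : ℝ} (hR : 0 < R) (k : ℕ) (c : ℂ → ℂ)
    (hc : DifferentiableOn ℂ c (Metric.ball 0 R)) :
    ∃ b : ℕ → ℂ, (fun w => c w - ∑ j ∈ Finset.range k, b j * w ^ j) =O[𝓝 0] fun w => ‖w‖ ^ k := by
  obtain ⟨p, hp⟩ := hc.analyticAt (Metric.ball_mem_nhds _ hR)
  refine ⟨p.coeff, (hp.isBigO_sub_partialSum_pow k).congr_left fun w => ?_⟩
  rw [zero_add, FormalMultilinearSeries.partialSum]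
  congr 1
  refine Finset.sum_congr rfl fun j _ => ?_
  rw [FormalMultilinearSeries.apply_eq_pow_smul_coeff, smul_eq_mul, mul_comm]

lemma AuxHol.taylor {R : ℝ} (hR : 0 < R) (k : ℕ) {h : ℂ → ℂ → ℂ} (hh : AuxHol R h) :
    ∃ a : Fin k × Fin k → ℂ, (fun x : ℂ × ℂ => h x.1 x.2 -
      ∑ α, a α * (x.1 ^ (α.1 : ℕ) * x.2 ^ (α.2 : ℕ))) =O[𝓝 0] fun x => ‖x‖ ^ k := by
  obtain ⟨c, g, hc, hg, hcg⟩ := hh.expand hR k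
  choose b hb using fun i => aux_taylor1 hR k (c i) (hc i)
  refine ⟨fun α => b α.1 α.2, ?_⟩
  have hfst : Filter.Tendsto (fun x : ℂ × ℂ => x.1) (𝓝 0) (𝓝 0) := continuous_fst.tendsto 0
  have hsnd : Filter.Tendsto (fun x : ℂ × ℂ => x.2) (𝓝 0) (𝓝 0) := continuous_snd.tendsto 0
  have hO1 : (fun x : ℂ × ℂ => x.1 ^ k * g x.1 x.2) =O[𝓝 0] fun x => ‖x‖ ^ k := by
    obtain ⟨M, hM⟩ := hg.bd
    refine Asymptotics.IsBigO.of_bound M ?_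
    filter_upwards [hfst (Metric.ball_mem_nhds _ hR), hsnd (Metric.ball_mem_nhds _ hR)] with x h1 h2
    have h3 := hM x.1 h1 x.2 h2
    rw [norm_mul, norm_pow, norm_pow, norm_norm, mul_comm]
    exact mul_le_mul h3 (pow_le_pow_left₀ (norm_nonneg _) (norm_fst_le x) _) (by positivity)
      ((norm_nonneg _).trans h3)
  have hO2 : ∀ i : ℕ, (fun x : ℂ × ℂ => x.1 ^ i * (c i x.2 - ∑ j ∈ Finset.range k, b i j * x.2 ^ j))
      =O[𝓝 0] fun x => ‖x‖ ^ k := by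
    intro i
    have e1 : (fun x : ℂ × ℂ => x.1 ^ i) =O[𝓝 0] fun _ => (1 : ℝ) :=
      Filter.Tendsto.isBigO_one ℝ ((continuous_fst.pow i).tendsto 0)
    have e2 := (hb i).comp_tendsto hsnd
    have e3 : (fun x : ℂ × ℂ => ‖x.2‖ ^ k) =O[𝓝 0] fun x => ‖x‖ ^ k := by
      refine Asymptotics.IsBigO.of_bound 1 (Filter.Eventually.of_forall fun x => ?_)
      simp only [norm_pow, norm_norm, one_mul]
      exact pow_le_pow_left₀ (norm_nonneg _) (norm_snd_le x) _
    have := e1.mul (e2.trans e3)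
    simpa using this
  have hO3 := (Asymptotics.IsBigO.fun_sum (s := Finset.range k) fun i _ => hO2 i).add hO1
  refine hO3.congr_left fun x => ?_
  rw [hcg, Fintype.sum_prod_type, Finset.sum_range, Finset.sum_range]
  have : ∀ i : Fin k, x.1 ^ (i : ℕ) * (c i x.2 - ∑ j ∈ Finset.range k, b i j * x.2 ^ j) =
      x.1 ^ (i : ℕ) * c i x.2 - ∑ j : Fin k, b i j * (x.1 ^ (i : ℕ) * x.2 ^ (j : ℕ)) := by
    intro i
    rw [mul_sub, Finset.sum_range, Finset.mul_sum]
    congr 1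
    refine Finset.sum_congr rfl fun j _ => ?_
    ring
  simp only [this, Finset.sum_sub_distrib]
  ring

/-- Parametrization of the Heisenberg hypersurface. -/
def auxPhi (t : Fin 3 → ℝ) : ℂ × ℂ :=
  (t 0 + t 1 * Complex.I, t 2 + (t 0 ^ 2 + t 1 ^ 2) * Complex.I)

def auxPhiL : (Fin 3 → ℝ) →L[ℝ] ℂ × ℂ :=
  LinearMap.toContinuousLinearMap
    { toFun := fun t => ((t 0 + t 1 * Complex.I, t 2) : ℂ × ℂ)
      map_add' := by intro s t; ext <;> simp <;> ring
      map_smul' := by intro s t; ext <;> simp <;> ring }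

lemma auxPhiL_apply (t : Fin 3 → ℝ) : auxPhiL t = ((t 0 + t 1 * Complex.I, t 2) : ℂ × ℂ) := rfl

lemma auxPhi_zero : auxPhi 0 = 0 := by ext <;> simp [auxPhi]

lemma auxPhiL_inj : Function.Injective auxPhiL := by
  rw [injective_iff_map_eq_zero]
  intro t ht
  rw [auxPhiL_apply, Prod.mk_eq_zero] at ht
  obtain ⟨h1, h2⟩ := ht
  have e0 := congrArg Complex.re h1
  have e1 := congrArg Complex.im h1
  have e2 := congrArg Complex.re h2
  simp at e0 e1 e2
  ext i
  fin_cases i <;> simp [e0, e1, e2]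

lemma auxPhi_deriv : HasFDerivAt auxPhi auxPhiL 0 := by
  have h1 : HasFDerivAt (fun t : Fin 3 → ℝ => ((0, ((t 0 ^ 2 + t 1 ^ 2 : ℝ) : ℂ) * Complex.I) : ℂ × ℂ))
      (0 : (Fin 3 → ℝ) →L[ℝ] ℂ × ℂ) 0 := by
    refine Asymptotics.IsBigO.hasFDerivAt (n := 2) ?_ (by norm_num)
    refine Asymptotics.IsBigO.of_bound 2 (Filter.Eventually.of_forall fun t => ?_)
    have a0 := norm_le_pi_norm t 0
    have a1 := norm_le_pi_norm t 1
    have b0 : t 0 ^ 2 ≤ ‖t‖ ^ 2 := by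
      rw [← sq_abs]; exact pow_le_pow_left₀ (abs_nonneg _) a0 2
    have b1 : t 1 ^ 2 ≤ ‖t‖ ^ 2 := by
      rw [← sq_abs]; exact pow_le_pow_left₀ (abs_nonneg _) a1 2
    rw [Prod.norm_mk, norm_zero, norm_mul, Complex.norm_I, mul_one, Complex.norm_real, sub_zero,
      Real.norm_eq_abs, abs_of_nonneg (by positivity : (0:ℝ) ≤ t 0 ^ 2 + t 1 ^ 2), norm_pow,
      norm_norm]
    exact max_le (by positivity) (by linarith)
  have h2 := (auxPhiL.hasFDerivAt (x := 0)).add h1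
  refine (h2.congr_of_eventuallyEq (Filter.Eventually.of_forall fun t => ?_)).congr_fderiv (by simp)
  simp [auxPhi, auxPhiL_apply]

/-- Complex valued functions whose real and imaginary part are polynomial. -/
def AuxPoly (f : (Fin 3 → ℝ) → ℂ) : Prop :=
  ∃ p : Bool → MvPolynomial (Fin 3) ℝ, ∀ t,
    f t = (MvPolynomial.eval t (p false) : ℝ) + (MvPolynomial.eval t (p true) : ℝ) * Complex.I

lemma AuxPoly.mul {f g : (Fin 3 → ℝ) → ℂ} (hf : AuxPoly f) (hg : AuxPoly g) :
    AuxPoly (fun t => f t * g t) := by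
  obtain ⟨p, hp⟩ := hf
  obtain ⟨q, hq⟩ := hg
  refine ⟨fun b => if b then p false * q true + p true * q false
    else p false * q false - p true * q true, fun t => ?_⟩
  simp only [hp, hq]
  apply Complex.ext <;> simp

lemma AuxPoly.pow {f : (Fin 3 → ℝ) → ℂ} (hf : AuxPoly f) (m : ℕ) :
    AuxPoly (fun t => f t ^ m) := by
  induction m with
  | zero => exact ⟨fun b => if b then 0 else 1, fun t => by simp⟩
  | succ m ih => simpa [pow_succ] using ih.mul hf

lemma aux_phi_poly (i j : ℕ) : AuxPoly (fun t => (auxPhi t).1 ^ i * (auxPhi t).2 ^ j) := by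
  refine AuxPoly.mul (AuxPoly.pow ?_ i) (AuxPoly.pow ?_ j)
  · exact ⟨fun b => if b then MvPolynomial.X 1 else MvPolynomial.X 0, fun t => by simp [auxPhi]⟩
  · exact ⟨fun b => if b then MvPolynomial.X 0 ^ 2 + MvPolynomial.X 1 ^ 2 else MvPolynomial.X 2,
      fun t => by simp [auxPhi]⟩

def auxP (i j : ℕ) : Bool → MvPolynomial (Fin 3) ℝ := (aux_phi_poly i j).choose

lemma auxP_spec (i j : ℕ) (t : Fin 3 → ℝ) : (auxPhi t).1 ^ i * (auxPhi t).2 ^ j =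
    (MvPolynomial.eval t (auxP i j false) : ℝ) +
      (MvPolynomial.eval t (auxP i j true) : ℝ) * Complex.I :=
  (aux_phi_poly i j).choose_spec t

/-- Parameter index. -/
abbrev AuxS (n k : ℕ) : Type := (Fin n × Bool) × (Fin (k + 1) × Fin (k + 1))

def auxG (n k : ℕ) (y : Fin n × Bool) : MvPolynomial (Fin 3) (MvPolynomial (AuxS n k) ℝ) :=
  if y.2 then
    ∑ α : Fin (k + 1) × Fin (k + 1),
      (MvPolynomial.C (MvPolynomial.X ((y.1, false), α)) *
        MvPolynomial.map MvPolynomial.C (auxP α.1 α.2 true) +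
      MvPolynomial.C (MvPolynomial.X ((y.1, true), α)) *
        MvPolynomial.map MvPolynomial.C (auxP α.1 α.2 false))
  else
    ∑ α : Fin (k + 1) × Fin (k + 1),
      (MvPolynomial.C (MvPolynomial.X ((y.1, false), α)) *
        MvPolynomial.map MvPolynomial.C (auxP α.1 α.2 false) -
      MvPolynomial.C (MvPolynomial.X ((y.1, true), α)) *
        MvPolynomial.map MvPolynomial.C (auxP α.1 α.2 true))

lemma auxG_eval {n k : ℕ} (a : Fin n → Fin (k + 1) × Fin (k + 1) → ℂ) (t : Fin 3 → ℝ)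
    (y : Fin n × Bool) :
    MvPolynomial.eval t (MvPolynomial.map (MvPolynomial.eval
      (fun s : AuxS n k => if s.1.2 then (a s.1.1 s.2).im else (a s.1.1 s.2).re)) (auxG n k y)) =
    if y.2 then (∑ α, a y.1 α * ((auxPhi t).1 ^ (α.1 : ℕ) * (auxPhi t).2 ^ (α.2 : ℕ))).im
    else (∑ α, a y.1 α * ((auxPhi t).1 ^ (α.1 : ℕ) * (auxPhi t).2 ^ (α.2 : ℕ))).re := by
  have hmap : ∀ (e : AuxS n k → ℝ) (p : MvPolynomial (Fin 3) ℝ),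
      MvPolynomial.map (MvPolynomial.eval e) (MvPolynomial.map MvPolynomial.C p) = p := by
    intro e p
    rw [MvPolynomial.map_map]
    have : (MvPolynomial.eval e).comp MvPolynomial.C = RingHom.id ℝ := by ext; simp
    rw [this, MvPolynomial.map_id]
  simp only [auxP_spec]
  obtain ⟨j, b⟩ := y
  cases b
  · simp [auxG, hmap]
  · simp [auxG, hmap]

/-- The universal matrix. -/
def auxA (n k : ℕ) : Matrix (AuxR k) (MIdx n k) (MvPolynomial (AuxS n k) ℝ) :=
  fun γ β => MvPolynomial.C (auxW n k β) * (∏ y, auxG n k y ^ (β.1 y : ℕ)).coeff (auxF γ)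

lemma auxA_map (n k : ℕ) (a : AuxS n k → ℝ) : (auxA n k).map (MvPolynomial.eval a) =
    auxB k (fun y => MvPolynomial.map (MvPolynomial.eval a) (auxG n k y)) := by
  ext γ β
  simp only [Matrix.map_apply, auxA, auxB, map_mul, MvPolynomial.eval_C]
  rw [← MvPolynomial.coeff_map]
  simp

lemma aux_card (n : ℕ) (hn : 1 ≤ n) :
    Fintype.card (AuxS n (3 * (18 * n))) < Fintype.card (AuxR (3 * (18 * n))) := by
  set m := 18 * n with hm
  have h1 : (m + 1) ^ 3 - 1 ≤ Fintype.card (AuxR (3 * m)) := by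
    have hc : Fintype.card {g : Fin 3 → Fin (m + 1) // g ≠ 0} = (m + 1) ^ 3 - 1 := by
      rw [Fintype.card_subtype_compl]; simp
    rw [← hc]
    have hle : ∀ x : Fin (m+1), (x : ℕ) < 3 * m + 1 := fun x => by have := x.2; omega
    refine Fintype.card_le_of_injective (fun g => ⟨fun i => ⟨(g.1 i : ℕ), hle _⟩, ?_, ?_⟩) ?_
    · by_contra hlt
      apply g.2
      have h0 : ∑ i, (g.1 i : ℕ) = 0 := by simpa using hlt
      rw [Finset.sum_eq_zero_iff] at h0
      ext i
      simpa using h0 i (Finset.mem_univ i)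
    · simp only [Fin.sum_univ_three]
      have a0 := (g.1 0).2
      have a1 := (g.1 1).2
      have a2 := (g.1 2).2
      omega
    · intro g g' hgg
      ext i
      have := congrArg (fun γ : AuxR (3 * m) => ((γ.1 i : Fin _) : ℕ)) hgg
      exact this
  refine lt_of_lt_of_le ?_ h1
  simp only [Fintype.card_prod, Fintype.card_fin, Fintype.card_bool]
  have : n * 2 * ((3 * m + 1) * (3 * m + 1)) + 1 < (m + 1) ^ 3 := by
    have e1 : (3 * m + 1) * (3 * m + 1) ≤ 9 * (m + 1) ^ 2 := by nlinarith
    have e2 : n * 2 * ((3 * m + 1) * (3 * m + 1)) ≤ m * (m + 1) ^ 2 := by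
      calc _ ≤ n * 2 * (9 * (m + 1) ^ 2) := Nat.mul_le_mul_left _ e1
        _ = m * (m + 1) ^ 2 := by rw [hm]; ring
    have e3 : (m + 1) ^ 3 = m * (m + 1) ^ 2 + (m + 1) ^ 2 := by ring
    have e4 : 1 < (m + 1) ^ 2 := by nlinarith
    omega
  omega


/-- The embedding of the `(z₁, w)`-plane into `ℂ^(N+1)`. -/
def auxIota (N : ℕ) (i0 : Fin N) : ℂ × ℂ →L[ℂ] Cn (N + 1) :=
  (ContinuousLinearMap.fst ℂ ℂ ℂ).smulRight (EuclideanSpace.single (Fin.castSucc i0) (1 : ℂ)) +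
  (ContinuousLinearMap.snd ℂ ℂ ℂ).smulRight (EuclideanSpace.single (Fin.last N) (1 : ℂ))

lemma auxIota_castSucc (N : ℕ) (i0 : Fin N) (x : ℂ × ℂ) (i : Fin N) :
    auxIota N i0 x (Fin.castSucc i) = if i = i0 then x.1 else 0 := by
  have : Fin.castSucc i ≠ Fin.last N := (Fin.castSucc_lt_last i).ne
  simp [auxIota, Pi.single_apply, this]

lemma auxIota_last (N : ℕ) (i0 : Fin N) (x : ℂ × ℂ) :
    auxIota N i0 x (Fin.last N) = x.2 := by
  have : Fin.last N ≠ Fin.castSucc i0 := (Fin.castSucc_lt_last i0).ne'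
  simp [auxIota, Pi.single_apply, this]

lemma auxIota_inj (N : ℕ) (i0 : Fin N) : Function.Injective (auxIota N i0) := by
  intro x y h
  have h1 := congrArg (fun v : Cn (N + 1) => v (Fin.castSucc i0)) h
  have h2 := congrArg (fun v : Cn (N + 1) => v (Fin.last N)) h
  simp only [auxIota_castSucc, auxIota_last, if_true] at h1 h2
  exact Prod.ext h1 h2

lemma aux_main {N n d k : ℕ} (hk : 1 ≤ k) (i0 : Fin N) (j0 : Fin d) (ρ' : Cn n → Fin d → ℝ)
    (hρ : AnalyticAt ℝ (fun w => ρ' w j0) 0) (hρ0 : ρ' 0 j0 = 0)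
    (V : Set (Cn (N + 1))) (Ψ : Cn (N + 1) → Cn n) (hV : IsOpen V) (h0 : (0 : Cn (N + 1)) ∈ V)
    (hΨ : DifferentiableOn ℂ Ψ V) (hinj : Function.Injective (fderiv ℂ Ψ 0)) (hΨ0 : Ψ 0 = 0)
    (hM : ∀ z ∈ V, (z (Fin.last N)).im = ∑ i : Fin N, Complex.normSq (z (Fin.castSucc i)) →
      ρ' (Ψ z) j0 = 0) :
    ∃ (a : AuxS n k → ℝ) (I : Fin 3 ↪ Fin n × Bool),
      ((auxA n k).map (MvPolynomial.eval a)).mulVec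
        (fun β => taylorCoeff k ρ' (β, j0)) = 0 ∧
      (((auxA n k).map (MvPolynomial.eval a)).submatrix id (auxExt I)).det ≠ 0 := by
  have hcont : ContinuousAt Ψ 0 := (hΨ.continuousOn).continuousAt (hV.mem_nhds h0)
  have hι0 : auxIota N i0 0 = 0 := map_zero _
  have hev : ∀ᶠ x in 𝓝 (0 : ℂ × ℂ), auxIota N i0 x ∈ V ∧ ‖Ψ (auxIota N i0 x)‖ ≤ 1 := by
    have h1 : Filter.Tendsto (auxIota N i0) (𝓝 0) (𝓝 0) := by
      simpa using (auxIota N i0).continuous.tendsto 0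
    have h2 : ∀ᶠ v in 𝓝 (0 : Cn (N + 1)), v ∈ V ∧ ‖Ψ v‖ ≤ 1 := by
      refine (hV.eventually_mem h0).and ?_
      have h3 : Filter.Tendsto (fun v => ‖Ψ v‖) (𝓝 0) (𝓝 0) := by
        simpa [hΨ0] using hcont.norm.tendsto
      exact (h3.eventually (gt_mem_nhds one_pos)).mono fun v hv => le_of_lt hv
    exact h1.eventually h2
  obtain ⟨R, hR, hball⟩ := Metric.eventually_nhds_iff_ball.mp hev
  have hbb : ∀ z ∈ Metric.ball (0 : ℂ) R, ∀ w ∈ Metric.ball (0 : ℂ) R,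
      auxIota N i0 (z, w) ∈ V ∧ ‖Ψ (auxIota N i0 (z, w))‖ ≤ 1 := by
    intro z hz w hw
    refine hball _ ?_
    rw [← Prod.mk_zero_zero, ← ball_prod_same]
    exact ⟨hz, hw⟩
  have hol : ∀ j : Fin n, AuxHol R (fun z w => Ψ (auxIota N i0 (z, w)) j) := by
    intro j
    have hj : DifferentiableOn ℂ (fun v => Ψ v j) V := by
      intro v hv
      exact ((EuclideanSpace.proj (𝕜 := ℂ) j).differentiableAt.comp_differentiableWithinAt v (hΨ v hv))
    refine ⟨fun w hw => ?_, fun z hz => ?_, 1, fun z hz w hw => ?_⟩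
    · refine hj.comp (t := V) (f := fun z => auxIota N i0 (z, w)) ?_ fun z hz => (hbb z hz w hw).1
      have : Differentiable ℂ (fun z : ℂ => auxIota N i0 (z, w)) := by fun_prop
      exact this.differentiableOn
    · refine hj.comp (t := V) (f := fun w => auxIota N i0 (z, w)) ?_ fun w hw => (hbb z hz w hw).1
      have : Differentiable ℂ (fun w : ℂ => auxIota N i0 (z, w)) := by fun_prop
      exact this.differentiableOn
    · exact (PiLp.norm_apply_le _ j).trans (hbb z hz w hw).2
  choose a ha using fun j => AuxHol.taylor hR (k + 1) (hol j)
  let e : AuxS n k → ℝ := fun s => if s.1.2 then (a s.1.1 s.2).im else (a s.1.1 s.2).re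
  let F : (Fin 3 → ℝ) → Cn n := fun t => Ψ (auxIota N i0 (auxPhi t))
  have hF0 : F 0 = 0 := by simp [F, auxPhi_zero, hΨ0]
  let D : (Fin 3 → ℝ) →L[ℝ] Cn n := ((fderiv ℂ Ψ 0).restrictScalars ℝ).comp
    (((auxIota N i0).restrictScalars ℝ).comp auxPhiL)
  have hFD : HasFDerivAt F D 0 := by
    have h1 : HasFDerivAt Ψ ((fderiv ℂ Ψ 0).restrictScalars ℝ) 0 :=
      ((hΨ.differentiableAt (hV.mem_nhds h0)).hasFDerivAt).restrictScalars ℝ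
    have h2 : HasFDerivAt (fun t => auxIota N i0 (auxPhi t))
        (((auxIota N i0).restrictScalars ℝ).comp auxPhiL) 0 :=
      (((auxIota N i0).restrictScalars ℝ).hasFDerivAt (x := auxPhi 0)).comp 0 auxPhi_deriv
    have h3 : auxIota N i0 (auxPhi 0) = 0 := by rw [auxPhi_zero, hι0]
    exact HasFDerivAt.comp (g := Ψ) (0 : Fin 3 → ℝ) (by rw [h3]; exact h1) h2
  have hD : Function.Injective D :=
    hinj.comp ((auxIota_inj N i0).comp auxPhiL_inj)
  have hPhi : Filter.Tendsto auxPhi (𝓝 0) (𝓝 0) := by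
    simpa [auxPhi_zero] using auxPhi_deriv.continuousAt.tendsto
  have hPhiO : auxPhi =O[𝓝 0] fun t => ‖t‖ := by
    have h := auxPhi_deriv.isBigO_sub
    simp only [auxPhi_zero, sub_zero] at h
    exact h.norm_right
  let G : Fin n × Bool → MvPolynomial (Fin 3) ℝ := fun y =>
    MvPolynomial.map (MvPolynomial.eval e) (auxG n k y)
  have hG : ∀ y, (fun t => MvPolynomial.eval t (G y) - auxRc (F t) y) =O[𝓝 0]
      fun t => ‖t‖ ^ (k + 1) := by
    intro y
    have h1 := (ha y.1).comp_tendsto hPhi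
    have h2 : (fun t => ‖auxPhi t‖ ^ (k + 1)) =O[𝓝 0] fun t => ‖t‖ ^ (k + 1) :=
      hPhiO.norm_left.pow (k + 1)
    have h3 := h1.trans h2
    refine Asymptotics.IsBigO.trans (Asymptotics.IsBigO.of_bound 1
      (Filter.Eventually.of_forall fun t => ?_)) h3
    simp only [G, e]
    rw [auxG_eval]
    simp only [Function.comp, one_mul, auxRc, F]
    rw [norm_sub_rev]
    split_ifs
    · rw [← Complex.sub_im]; exact Complex.abs_im_le_norm _
    · rw [← Complex.sub_re]; exact Complex.abs_re_le_norm _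
  have hz : ∀ᶠ t in 𝓝 0, ρ' (F t) j0 = 0 := by
    filter_upwards [hPhi.eventually hev] with t ht
    refine hM _ ht.1 ?_
    rw [auxIota_last]
    simp only [auxIota_castSucc]
    rw [Finset.sum_eq_single i0 (fun i _ hi => by simp [hi]) (by simp)]
    have : Complex.normSq ((t 0 : ℂ) + t 1 * Complex.I) = t 0 ^ 2 + t 1 ^ 2 :=
      Complex.normSq_add_mul_I _ _
    simp only [if_true, auxPhi]
    rw [this]
    have h5 : ((t 0 : ℂ) ^ 2 + (t 1 : ℂ) ^ 2) = ((t 0 ^ 2 + t 1 ^ 2 : ℝ) : ℂ) := by push_cast; rfl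
    rw [h5]
    simp [-Complex.ofReal_add, -Complex.ofReal_pow]
  obtain ⟨I, hI⟩ := aux_core2 G F hF0 D hFD hG hk hD
  refine ⟨e, I, ?_, ?_⟩
  · rw [auxA_map]
    exact aux_core1 G F hF0 D hFD hG (fun w => ρ' w j0) hρ hρ0 hz
  · rw [auxA_map]
    exact hI

/-- **Lemma 5.1.** Let `2N > N'` and `M = {Im w = |z₁|² + ⋯ + |z_N|²} ⊆ ℂ^{N+1}`.  There are
`k₀ ∈ ℕ` and a nonzero polynomial function `Q` on the space `P_{k₀}` of `k₀`-jets of defining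
functions `ρ' : ℂ^{N'+1} → ℝ^d` such that `Q` vanishes on the `k₀`-jet of every local defining
function whose zero set admits a local holomorphic embedding of `M` through `0`. -/
theorem jets_of_embeddable_defining_functions_contained_in_proper_algebraic_subset
    {N N' d : ℕ} (hd : 1 ≤ d) (h2N : N' < 2 * N)
    (M : Set (Cn (N + 1)))
    (hM : M = {v : Cn (N + 1) |
      (v (Fin.last N)).im = ∑ i : Fin N, Complex.normSq (v (Fin.castSucc i))}) :
    ∃ (k₀ : ℕ) (Q : MvPolynomial (MIdx (N' + 1) k₀ × Fin d) ℝ),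
      (∃ c : MIdx (N' + 1) k₀ × Fin d → ℝ, MvPolynomial.eval c Q ≠ 0) ∧
      ∀ (U : Set (Cn (N' + 1))) (ρ' : Cn (N' + 1) → Fin d → ℝ),
        IsOpen U → (0 : Cn (N' + 1)) ∈ U →
        (∀ i, AnalyticOnNhd ℝ (fun w => ρ' w i) U) → (∀ i, ρ' 0 i = 0) →
        (∃ (V : Set (Cn (N + 1))) (Ψ : Cn (N + 1) → Cn (N' + 1)),
          IsOpen V ∧ (0 : Cn (N + 1)) ∈ V ∧ DifferentiableOn ℂ Ψ V ∧
          Set.InjOn Ψ V ∧ (∀ z ∈ V, Function.Injective (fderiv ℂ Ψ z)) ∧ Ψ 0 = 0 ∧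
          (∀ z ∈ M ∩ V, Ψ z ∈ U ∧ ∀ i, ρ' (Ψ z) i = 0)) →
        MvPolynomial.eval (taylorCoeff k₀ ρ') Q = 0 := by
  classical
  have hN : 0 < N := by omega
  let i0 : Fin N := ⟨0, hN⟩
  let j0 : Fin d := ⟨0, hd⟩
  set n := N' + 1 with hn
  set k := 3 * (18 * n) with hk
  have hk1 : 1 ≤ k := by omega
  have key := fun I : Fin 3 ↪ Fin n × Bool =>
    aux_elim (auxA n k) (auxExt I) (auxExt_inj I) (aux_card n (by omega))
  choose Q hQ0 hQ using key
  have hinj : Function.Injective (fun β : MIdx n k => (β, j0)) := fun x y h => (Prod.mk.inj h).1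
  refine ⟨k, MvPolynomial.rename (fun β => (β, j0)) (∏ I, Q I), ?_, ?_⟩
  · by_contra hcon
    push Not at hcon
    have h1 : MvPolynomial.rename (fun β : MIdx n k => (β, j0)) (∏ I, Q I) = 0 :=
      MvPolynomial.funext fun c => by rw [hcon c, map_zero]
    have h2 := MvPolynomial.rename_injective _ hinj (h1.trans (map_zero _).symm)
    exact Finset.prod_ne_zero_iff.mpr (fun I _ => hQ0 I) h2
  · rintro U ρ' hU hU0 hρ hρ0 ⟨V, Ψ, hV, h0, hΨ, -, hder, hΨ0, hMV⟩
    obtain ⟨a, I, h1, h2⟩ := aux_main hk1 i0 j0 ρ' (hρ j0 0 hU0) (hρ0 j0) V Ψ hV h0 hΨ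
      (hder 0 h0) hΨ0 (fun z hz hzM => (hMV z ⟨by rw [hM]; exact hzM, hz⟩).2 j0)
    rw [MvPolynomial.eval_rename, map_prod]
    exact Finset.prod_eq_zero (Finset.mem_univ I) (hQ I a _ h1 h2)

end
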